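/- In the free associative algebra A over a field of characteristic zero, if j or k is odd then M_j · M_k ⊆ M_{j+k−1}, where M_i is the two-sided ideal generated by the i-th term L_i of the lower central series. -/

import Mathlib

/-- The commutator `[a,b] = a*b - b*a`. -/
def br {A : Type*} [Ring A] (a b : A) : A := a * b - b * a

/-- Lower central series: `lcs K A 1 = A`, `lcs K A (k+1) = span {[a,l] | a ∈ A, l ∈ lcs K A k}`. -/
def lcs (K : Type*) [Field K] (A : Type*) [Ring A] [Algebra K A] : ℕ → Submodule K A
  | 0 => ⊤
  | 1 => ⊤
  | (k+2) => Submodule.span K {x : A | ∃ a l : A, l ∈ lcs K A (k+1) ∧ x = a * l - l * a}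

/-- `mIdeal K A j = A·L_j·A`, the two-sided ideal generated by `L_j`. -/
def mIdeal (K : Type*) [Field K] (A : Type*) [Ring A] [Algebra K A] (j : ℕ) : Submodule K A :=
  Submodule.span K {x : A | ∃ a l b : A, l ∈ lcs K A j ∧ x = a * l * b}

section helpers

variable {K : Type*} [Field K] {A : Type*} [Ring A] [Algebra K A]

theorem lcs_br_left {k : ℕ} (hk : 1 ≤ k) (a : A) {l : A} (hl : l ∈ lcs K A k) :
    br a l ∈ lcs K A (k + 1) := by
  obtain ⟨k, rfl⟩ : ∃ m, k = m + 1 := ⟨k - 1, by omega⟩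
  exact Submodule.subset_span ⟨a, l, hl, rfl⟩

theorem br_neg_swap (a b : A) : br a b = - br b a := by simp [br]

theorem lcs_br_right {k : ℕ} (hk : 1 ≤ k) (a : A) {l : A} (hl : l ∈ lcs K A k) :
    br l a ∈ lcs K A (k + 1) := by
  rw [br_neg_swap]; exact neg_mem (lcs_br_left hk a hl)

theorem lcs_one_mem (a : A) : a ∈ lcs K A 1 := by simp [lcs]

/-- Induction principle for `lcs`. -/
theorem lcs_succ_induction {k : ℕ} (hk : 1 ≤ k) (S : Submodule K A) (f : A →ₗ[K] A)
    (h : ∀ a l : A, l ∈ lcs K A k → f (br a l) ∈ S) {x : A} (hx : x ∈ lcs K A (k + 1)) :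
    f x ∈ S := by
  obtain ⟨k, rfl⟩ : ∃ m, k = m + 1 := ⟨k - 1, by omega⟩
  have : lcs K A (k + 2) ≤ S.comap f := by
    rw [lcs, Submodule.span_le]
    rintro _ ⟨a, l, hl, rfl⟩
    exact h a l hl
  exact this hx

theorem lcs_succ_le {k : ℕ} (hk : 1 ≤ k) : lcs K A (k + 1) ≤ lcs K A k := by
  induction k, hk using Nat.le_induction with
  | base => intro x _; exact lcs_one_mem x
  | succ k hk ih =>
    intro x hx
    exact lcs_succ_induction (by omega) (lcs K A (k + 1)) LinearMap.id
      (fun a l hl => lcs_br_left hk a (ih hl)) hx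

/-- The map `m ↦ [y,m]`. -/
def brL (K : Type*) [Field K] {A : Type*} [Ring A] [Algebra K A] (y : A) : A →ₗ[K] A :=
  LinearMap.mulLeft K y - LinearMap.mulRight K y

theorem brL_apply (y m : A) : brL K y m = br y m := by simp [brL, br]

theorem br_jacobi (y a m : A) : br y (br a m) = br (br y a) m + br a (br y m) := by
  simp only [br]; noncomm_ring

theorem lcs_br {i k : ℕ} (hi : 1 ≤ i) (hk : 1 ≤ k) {u v : A} (hu : u ∈ lcs K A i)
    (hv : v ∈ lcs K A k) : br u v ∈ lcs K A (i + k) := by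
  induction k, hk using Nat.le_induction generalizing i u v with
  | base => exact lcs_br_right hi v hu
  | succ k hk ih =>
    rw [← brL_apply (K := K)]
    refine lcs_succ_induction hk _ (brL K u) (fun a m hm => ?_) hv
    rw [brL_apply, br_jacobi]
    refine add_mem ?_ ?_
    · have := ih (i := i + 1) (by omega) (lcs_br_right hi a hu) hm
      rwa [show i + 1 + k = i + (k + 1) by omega] at this
    · exact lcs_br_left (k := i + k) (by omega) a (ih hi hu hm)

/-- `[M_j, A] ⊆ L_{j+1}`. -/
def PP (K : Type*) [Field K] (A : Type*) [Ring A] [Algebra K A] (j : ℕ) : Prop :=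
  ∀ x l d : A, l ∈ lcs K A j → br (x * l) d ∈ lcs K A (j + 1)

theorem PP.lcs {j : ℕ} (hj : 1 ≤ j) (h : PP K A j) {k : ℕ} (hk : 1 ≤ k) (x : A) {l m : A}
    (hl : l ∈ lcs K A j) (hm : m ∈ lcs K A k) : br (x * l) m ∈ lcs K A (j + k) := by
  induction k, hk using Nat.le_induction generalizing m with
  | base => exact h x l m hl
  | succ k hk ih =>
    rw [← brL_apply (K := K)]
    refine lcs_succ_induction hk _ (brL K (x * l)) (fun a m hm => ?_) hm
    rw [brL_apply, br_jacobi]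
    refine add_mem ?_ ?_
    · have := lcs_br (i := j + 1) (by omega) hk (h x l a hl) hm
      rwa [show j + 1 + k = j + (k + 1) by omega] at this
    · exact lcs_br_left (k := j + k) (by omega) a (ih hm)

theorem anti_xd {j : ℕ} (hj : 1 ≤ j) (x d : A) {l : A} (hl : l ∈ lcs K A j) :
    br (x * l) d + br (d * l) x ∈ lcs K A (j + 1) := by
  have e : br (x * l) d + br (d * l) x = br (br d l) x - br (d * x) l := by
    simp only [br]; noncomm_ring
  rw [e]
  exact sub_mem (lcs_succ_le (by omega) (lcs_br_right (by omega) x (lcs_br_left hj d hl)))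
    (lcs_br_left hj _ hl)

theorem anti_xc {i : ℕ} (hi : 1 ≤ i) (x c d : A) {m : A} (hm : m ∈ lcs K A i) :
    br (x * br m c) d + br (c * br m x) d ∈ lcs K A (i + 2) := by
  have e : br (x * br m c) d + br (c * br m x) d
      = br (br m (x * c)) d + br (br c (br m x)) d := by
    simp only [br]; noncomm_ring
  rw [e]
  exact add_mem (lcs_br_right (by omega) d (lcs_br_right hi _ hm))
    (lcs_succ_le (by omega) (lcs_br_right (by omega) d
      (lcs_br_left (by omega) _ (lcs_br_right hi _ hm))))

variable [CharZero K]

set_option linter.unusedSectionVars false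

theorem two_zero {Q : Type*} [AddCommGroup Q] [Module K Q] {q : Q} (h : q = -q) : q = 0 := by
  have : (2 : K) • q = 0 := by
    rw [two_smul]; nth_rewrite 1 [h]; simp
  simpa using this

theorem three_zero {Q : Type*} [AddCommGroup Q] [Module K Q] {q : Q} (h : q + q + q = 0) :
    q = 0 := by
  have : (3 : K) • q = 0 := by
    rw [← h]; module
  simpa using this

theorem four_zero {Q : Type*} [AddCommGroup Q] [Module K Q] (G : A → A → A → Q)
    (h1 : ∀ e c x, G e c x = G c e x) (h2 : ∀ e c x, G e c x = - G e x c) (e c x : A) :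
    G e c x = 0 := by
  apply two_zero (K := K)
  calc G e c x = G c e x := h1 _ _ _
    _ = - G c x e := h2 _ _ _
    _ = - G x c e := by rw [h1]
    _ = G x e c := by rw [h2, neg_neg]
    _ = G e x c := h1 _ _ _
    _ = - G e c x := h2 _ _ _

theorem five_zero {Q : Type*} [AddCommGroup Q] [Module K Q] (T : A → A → A → A → A → Q)
    (h1 : ∀ a b c x d, T a b c x d = - T b a c x d)
    (h2 : ∀ a b c x d, T a b c x d = - T a b x c d)
    (h3 : ∀ a b c x d, T a b c x d = - T a b c d x)
    (h4 : ∀ a b c x d, T a b c x d + T b c a x d + T c a b x d = 0) (a b c x d : A) :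
    T a b c x d = 0 := by
  have cyc : ∀ a b c x d, T a b c x d = T a b d c x := by
    intro a b c x d
    rw [h3, h2, neg_neg]
  have sw : ∀ a b c x d, T a b c x d = T c x a b d := by
    intro a b c x d
    have e1 := h4 a b c x d
    have e2 := h4 a b x c d
    have e3 := h4 c x a b d
    have e4 := h4 c x b a d
    rw [h2 a b x c d] at e2
    rw [h2 x a c b d, h1 a c x b d, h2 c a x b d, neg_neg] at e3
    rw [h2 c x b a d, h2 x b c a d, h1 x b a c d, h2 b c x a d, neg_neg] at e4
    have : (2 : K) • (T a b c x d - T c x a b d) = 0 := by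
      linear_combination (norm := module) e1 - e2 - e3 + e4
    have := (smul_eq_zero.mp this).resolve_left (by norm_num)
    exact sub_eq_zero.mp this
  have rot : ∀ a b c x d, T a b c x d = T b c a x d := by
    intro a b c x d
    calc T a b c x d = T c x a b d := sw _ _ _ _ _
      _ = T c x d a b := cyc _ _ _ _ _
      _ = T d a c x b := sw _ _ _ _ _
      _ = T d a b c x := cyc _ _ _ _ _
      _ = T b c d a x := sw _ _ _ _ _
      _ = T b c x d a := cyc _ _ _ _ _
      _ = T b c a x d := cyc _ _ _ _ _
  apply three_zero (K := K)
  have := h4 a b c x d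
  rwa [rot c a b x d, ← rot a b c x d] at this

/-- The class of an element modulo `L_j`. -/
theorem mk_eq_neg {j : ℕ} {u v : A} (h : u + v ∈ lcs K A j) :
    (lcs K A j).mkQ u = - (lcs K A j).mkQ v := by
  rw [eq_neg_iff_add_eq_zero, ← map_add]
  exact (Submodule.Quotient.mk_eq_zero _).mpr h

theorem PP_three : PP K A 3 := by
  intro x l d hl
  have key : ∀ a b c x d : A, br (x * br (br a b) c) d ∈ lcs K A 4 := by
    intro a b c x d
    have hm : ∀ a b : A, br a b ∈ lcs K A 2 := fun a b =>
      lcs_br_left (k := 1) le_rfl a (lcs_one_mem b)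
    have := five_zero (K := K) (A := A)
      (fun a b c x d => (lcs K A 4).mkQ (br (x * br (br a b) c) d)) ?_ ?_ ?_ ?_ a b c x d
    · simpa using this
    · intro a b c x d
      rw [← map_neg]; congr 1
      simp only [br]; noncomm_ring
    · intro a b c x d
      exact mk_eq_neg (anti_xc (by omega) x c d (hm a b))
    · intro a b c x d
      exact mk_eq_neg (anti_xd (by omega) x d (lcs_br_right (by omega) c (hm a b)))
    · intro a b c x d
      simp only [← map_add]
      have e : br (x * br (br a b) c) d + br (x * br (br b c) a) d
          + br (x * br (br c a) b) d = 0 := by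
        simp only [br]; noncomm_ring
      rw [e, map_zero]
  have e : ∀ l : A, (brL K d ∘ₗ LinearMap.mulLeft K x) l = - br (x * l) d := by
    intro l
    simp [brL_apply, br]
  rw [← neg_mem_iff, ← e]
  refine lcs_succ_induction (k := 2) (by omega) _ _ (fun c m hm => ?_) hl
  rw [e, neg_mem_iff]
  have e' : ∀ m : A, (brL K d ∘ₗ LinearMap.mulLeft K x ∘ₗ brL K c) m = - br (x * br c m) d := by
    intro l
    simp [brL_apply, br]
  rw [← neg_mem_iff, ← e']
  refine lcs_succ_induction (k := 1) (by omega) _ _ (fun a b _ => ?_) hm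
  rw [e']
  have := key a b c x d
  convert this using 1
  simp only [br]; noncomm_ring

theorem PP_step {p : ℕ} (hp : 1 ≤ p) (h : PP K A p) (h3 : PP K A 3) : PP K A (p + 2) := by
  intro x l d hl
  have R : ∀ n ∈ lcs K A p, ∀ e c x d : A, br (x * br n (br e c)) d ∈ lcs K A (p + 3) := by
    intro n hn e c x d
    have hv : br e c ∈ lcs K A 2 := lcs_br_left (k := 1) le_rfl e (lcs_one_mem c)
    generalize br e c = v at hv
    have hy : br x v ∈ lcs K A 3 := lcs_br_left (by omega) x hv
    have e1 : br (x * br n v) d = br (br (x * n) v) d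
        + (br (d * n) (br x v) + br (br n d) (br x v) + br (d * br x v) n) := by
      simp only [br]; noncomm_ring
    rw [e1]
    refine add_mem ?_ (add_mem (add_mem ?_ ?_) ?_)
    · exact lcs_br_right (k := p + 2) (by omega) d (h.lcs hp (by omega) x hn hv)
    · exact h.lcs hp (by omega) d hn hy
    · apply lcs_succ_le (by omega)
      have := lcs_br (i := p + 1) (by omega) (by omega) (lcs_br_right hp d hn) hy
      rwa [show p + 1 + 3 = p + 3 + 1 by omega] at this
    · have := h3.lcs (by omega) hp d hy hn
      rwa [add_comm 3 p] at this
  have key : ∀ n ∈ lcs K A p, ∀ e c x : A, br (x * br (br n e) c) d ∈ lcs K A (p + 3) := by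
    intro n hn e c x
    have := four_zero (K := K) (A := A)
      (fun e c x => (lcs K A (p + 3)).mkQ (br (x * br (br n e) c) d)) ?_ ?_ e c x
    · simpa using this
    · intro e c x
      rw [← sub_eq_zero, ← map_sub]
      have := R n hn e c x d
      rw [show br (x * br (br n e) c) d - br (x * br (br n c) e) d = br (x * br n (br e c)) d by
        simp only [br]; noncomm_ring]
      simpa using this
    · intro e c x
      exact mk_eq_neg (anti_xc (i := p + 1) (by omega) x c d (lcs_br_right hp e hn))
  have e : ∀ l : A, (brL K d ∘ₗ LinearMap.mulLeft K x) l = - br (x * l) d := by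
    intro l
    simp [brL_apply, br]
  rw [← neg_mem_iff, ← e]
  refine lcs_succ_induction (k := p + 1) (by omega) _ _ (fun c m hm => ?_) hl
  rw [e, neg_mem_iff]
  have e' : ∀ m : A, (brL K d ∘ₗ LinearMap.mulLeft K x ∘ₗ brL K c) m = - br (x * br c m) d := by
    intro l
    simp [brL_apply, br]
  rw [← neg_mem_iff, ← e']
  refine lcs_succ_induction (k := p) (by omega) _ _ (fun a n hn => ?_) hm
  rw [e', neg_mem_iff]
  have := key n hn a c x
  convert this using 1
  simp only [br]; noncomm_ring

theorem PP_odd (i : ℕ) : PP K A (2 * i + 1) := by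
  induction i with
  | zero =>
    intro x l d _
    exact lcs_br_left (k := 1) le_rfl _ (lcs_one_mem d)
  | succ i ih => exact PP_step (by omega) ih PP_three

theorem mIdeal_mul_left {i : ℕ} (u : A) {x : A} (hx : x ∈ mIdeal K A i) :
    u * x ∈ mIdeal K A i := by
  have : mIdeal K A i ≤ (mIdeal K A i).comap (LinearMap.mulLeft K u) := by
    conv_lhs => rw [mIdeal]
    rw [Submodule.span_le]
    rintro _ ⟨a, l, b, hl, rfl⟩
    exact Submodule.subset_span ⟨u * a, l, b, hl, by simp [mul_assoc]⟩
  exact this hx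

theorem mIdeal_mul_right {i : ℕ} (u : A) {x : A} (hx : x ∈ mIdeal K A i) :
    x * u ∈ mIdeal K A i := by
  have : mIdeal K A i ≤ (mIdeal K A i).comap (LinearMap.mulRight K u) := by
    conv_lhs => rw [mIdeal]
    rw [Submodule.span_le]
    rintro _ ⟨a, l, b, hl, rfl⟩
    exact Submodule.subset_span ⟨a, l, b * u, hl, by simp [mul_assoc]⟩
  exact this hx

theorem lcs_le_mIdeal {i : ℕ} {x : A} (hx : x ∈ lcs K A i) : x ∈ mIdeal K A i :=
  Submodule.subset_span ⟨1, x, 1, hx, by simp⟩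

theorem lcs_mul_lcs {j k : ℕ} (hj : Odd j) (hk : 1 ≤ k) {l m : A}
    (hl : l ∈ lcs K A j) (hm : m ∈ lcs K A k) : l * m ∈ mIdeal K A (j + k - 1) := by
  obtain ⟨i, rfl⟩ := hj
  have hP : PP K A (2 * i + 1) := PP_odd i
  generalize hj : 2 * i + 1 = j at *
  have hj1 : 1 ≤ j := by omega
  obtain rfl | hk2 := hk.eq_or_lt
  · exact mIdeal_mul_right m (lcs_le_mIdeal hl)
  obtain ⟨k, rfl⟩ : ∃ q, k = q + 1 := ⟨k - 1, by omega⟩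
  have hk1 : 1 ≤ k := by omega
  rw [show j + (k + 1) - 1 = j + k by omega]
  refine lcs_succ_induction hk1 (mIdeal K A (j + k)) (LinearMap.mulLeft K l)
    (fun p n hn => ?_) hm
  have e : LinearMap.mulLeft K l (br p n) = br (p * l) n + br (br l p) n - br l n * p := by
    simp only [LinearMap.mulLeft_apply, br]; noncomm_ring
  rw [e]
  refine sub_mem (add_mem (lcs_le_mIdeal ?_) (lcs_le_mIdeal ?_))
    (mIdeal_mul_right p (lcs_le_mIdeal ?_))
  · exact hP.lcs hj1 hk1 p hl hn
  · apply lcs_succ_le (by omega)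
    have := lcs_br (i := j + 1) (by omega) hk1 (lcs_br_right hj1 p hl) hn
    rwa [show j + 1 + k = j + k + 1 by omega] at this
  · exact lcs_br hj1 hk1 hl hn

theorem lcs_mul_lcs' {j k : ℕ} (hj1 : 1 ≤ j) (hk : 1 ≤ k) (h : Odd j ∨ Odd k) {l m : A}
    (hl : l ∈ lcs K A j) (hm : m ∈ lcs K A k) : l * m ∈ mIdeal K A (j + k - 1) := by
  rcases h with h | h
  · exact lcs_mul_lcs h hk hl hm
  · rw [show l * m = m * l + br l m by simp [br]]
    refine add_mem ?_ (lcs_le_mIdeal (lcs_succ_le (by omega) ?_))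
    · have := lcs_mul_lcs h hj1 hm hl
      rwa [add_comm k j] at this
    · rw [show j + k - 1 + 1 = j + k by omega]
      exact lcs_br hj1 hk hl hm

end helpers

/-- In the free associative algebra over a field of characteristic zero, if `j` or `k`
is odd then `M_j · M_k ⊆ M_{j+k-1}`. -/
theorem mIdeal_mul_mIdeal_subset
    (K : Type*) [Field K] [CharZero K] (X : Type*)
    (j k : ℕ) (hj1 : 1 ≤ j) (hk1 : 1 ≤ k) (hodd : Odd j ∨ Odd k)
    (a : FreeAlgebra K X) (ha : a ∈ mIdeal K (FreeAlgebra K X) j)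
    (b : FreeAlgebra K X) (hb : b ∈ mIdeal K (FreeAlgebra K X) k) :
    a * b ∈ mIdeal K (FreeAlgebra K X) (j + k - 1) := by
  have key : ∀ x l y u m v : FreeAlgebra K X, l ∈ lcs K _ j → m ∈ lcs K _ k →
      (x * l * y) * (u * m * v) ∈ mIdeal K (FreeAlgebra K X) (j + k - 1) := by
    intro x l y u m v hl hm
    have e : (x * l * y) * (u * m * v)
        = x * ((l * m) * (y * u) + l * br (y * u) m) * v := by
      simp only [br]; noncomm_ring
    rw [e]
    refine mIdeal_mul_right _ (mIdeal_mul_left _ (add_mem (mIdeal_mul_right _ ?_) ?_))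
    · exact lcs_mul_lcs' hj1 hk1 hodd hl hm
    · exact lcs_mul_lcs' hj1 hk1 hodd hl (lcs_succ_le hk1 (lcs_br_left hk1 _ hm))
  have h2 : mIdeal K (FreeAlgebra K X) j * mIdeal K (FreeAlgebra K X) k
      ≤ mIdeal K (FreeAlgebra K X) (j + k - 1) := by
    conv_lhs => rw [mIdeal, mIdeal]
    rw [Submodule.span_mul_span, Submodule.span_le]
    rintro _ ⟨_, ⟨x, l, y, hl, rfl⟩, _, ⟨u, m, v, hm, rfl⟩, rfl⟩
    exact key x l y u m v hl hm
  exact h2 (Submodule.mul_mem_mul ha hb)
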